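/- For every function f : ℤ → ℂ, on the space of finitely supported sequences one has the operator identity 𝔏*_L(f(N)) = −N(N−I)·(f(N) − f(N−2)) + (α²/2)·a²·(f(N) − f(N−2)) + (α²/2)·(f(N) − f(N−2))·(a†)², where f(N) and f(N−2) are the diagonal operators with f(N)e_n = f(n)e_n and f(N−2)e_n = f(n−2)e_n. -/

import Mathlib

/-!
STATEMENT 3: For every function f : ℤ → ℂ, on the space of finitely supported
sequences one has the operator identity
𝔏*_L(f(N)) = −N(N−I)·(f(N) − f(N−2)) + (α²/2)·a²·(f(N) − f(N−2))
             + (α²/2)·(f(N) − f(N−2))·(a†)²,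
where f(N) and f(N−2) are the diagonal operators with f(N)e_n = f(n)e_n and
f(N−2)e_n = f(n−2)e_n.
-/

noncomputable section

abbrev FockSpace : Type := ℕ →₀ ℂ

/-- The annihilation operator `a`: `a e_n = √n e_{n-1}` (and `a e_0 = 0`),
equivalently `(a ψ)(n) = √(n+1) ψ(n+1)`. -/
noncomputable def ann : Module.End ℂ FockSpace :=
  Finsupp.lsum ℂ fun n => (Real.sqrt n : ℂ) • Finsupp.lsingle (n - 1)

/-- The creation operator `a†`: `a† e_n = √(n+1) e_{n+1}`. -/
noncomputable def cre : Module.End ℂ FockSpace :=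
  Finsupp.lsum ℂ fun n => (Real.sqrt (n + 1) : ℂ) • Finsupp.lsingle (n + 1)

/-- The number operator `N = a†a`. -/
noncomputable def numOp : Module.End ℂ FockSpace := cre * ann

/-- `L = a² − α²·I`. -/
noncomputable def Lop (α : ℝ) : Module.End ℂ FockSpace :=
  ann ^ 2 - ((α : ℂ) ^ 2) • 1

/-- `L† = (a†)² − α²·I`. -/
noncomputable def Ldag (α : ℝ) : Module.End ℂ FockSpace :=
  cre ^ 2 - ((α : ℂ) ^ 2) • 1

/-- The adjoint Lindblad super-operator `𝔏*_A(ξ) = A†ξA − (A†Aξ + ξA†A)/2`,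
with the adjoint `A†` supplied explicitly. -/
noncomputable def adjLind (A Adag ξ : Module.End ℂ FockSpace) : Module.End ℂ FockSpace :=
  Adag * ξ * A - (2⁻¹ : ℂ) • (Adag * A * ξ + ξ * (Adag * A))

/-- The diagonal operator `h(N)` with `h(N) e_n = h(n) e_n` for `h : ℤ → ℂ`. -/
noncomputable def diagOp (h : ℤ → ℂ) : Module.End ℂ FockSpace :=
  Finsupp.lsum ℂ fun n => h n • Finsupp.lsingle n

theorem ann_single (n : ℕ) (c : ℂ) :
    ann (Finsupp.single n c) = Finsupp.single (n - 1) ((Real.sqrt n : ℂ) * c) := by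
  simp [ann]

theorem cre_single (n : ℕ) (c : ℂ) :
    cre (Finsupp.single n c) = Finsupp.single (n + 1) ((Real.sqrt (n + 1) : ℂ) * c) := by
  simp [cre]

theorem diagOp_single (h : ℤ → ℂ) (n : ℕ) (c : ℂ) :
    diagOp h (Finsupp.single n c) = Finsupp.single n (h n * c) := by
  simp [diagOp]

theorem diagOp_sub (g h : ℤ → ℂ) : diagOp (fun n => g n - h n) = diagOp g - diagOp h := by
  refine Finsupp.lhom_ext fun n c => ?_
  simp [diagOp_single, sub_mul]

theorem diagOp_mul_ann (h : ℤ → ℂ) :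
    diagOp h * ann = ann * diagOp (fun n => h (n - 1)) := by
  refine Finsupp.lhom_ext fun n c => ?_
  cases n with
  | zero => simp [ann_single, diagOp_single, -Finsupp.single_mul]
  | succ n => simp [ann_single, diagOp_single, mul_left_comm, -Finsupp.single_mul]

theorem cre_mul_diagOp (h : ℤ → ℂ) :
    cre * diagOp h = diagOp (fun n => h (n - 1)) * cre := by
  refine Finsupp.lhom_ext fun n c => ?_
  simp [cre_single, diagOp_single, mul_left_comm, -Finsupp.single_mul]

theorem diagOp_mul_ann_sq (h : ℤ → ℂ) :
    diagOp h * ann ^ 2 = ann ^ 2 * diagOp (fun n => h (n - 2)) := by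
  rw [pow_two, ← mul_assoc, diagOp_mul_ann, mul_assoc, diagOp_mul_ann, ← mul_assoc]
  simp only [sub_sub]
  norm_num

theorem cre_sq_mul_diagOp (h : ℤ → ℂ) :
    cre ^ 2 * diagOp h = diagOp (fun n => h (n - 2)) * cre ^ 2 := by
  rw [pow_two, mul_assoc, cre_mul_diagOp, ← mul_assoc, cre_mul_diagOp, mul_assoc]
  simp only [sub_sub]
  norm_num

/-- The canonical commutation relation. -/
theorem ann_mul_cre : ann * cre = cre * ann + 1 := by
  refine Finsupp.lhom_ext fun n c => ?_
  have sqrt_mul_sqrt (m : ℕ) (d : ℂ) :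
      (Real.sqrt m : ℂ) * ((Real.sqrt m : ℂ) * d) = m * d := by
    rw [← mul_assoc, ← Complex.ofReal_mul, Real.mul_self_sqrt m.cast_nonneg,
      Complex.ofReal_natCast]
  have hs := sqrt_mul_sqrt (n + 1) c
  push_cast at hs
  cases n with
  | zero => simp [ann_single, cre_single]
  | succ n =>
    have ht := sqrt_mul_sqrt (n + 1) c
    push_cast at hs ht
    simp [ann_single, cre_single, hs, ht, ← Finsupp.single_add, add_mul, -Finsupp.single_mul]

theorem sq_mul_sq_of_mul_eq_mul_add_one {R : Type*} [Ring R] {a c : R}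
    (h : a * c = c * a + 1) : c ^ 2 * a ^ 2 = c * a * (c * a - 1) := by
  have hca : c * a = a * c - 1 := eq_sub_of_add_eq h.symm
  calc c ^ 2 * a ^ 2 = c * (c * a) * a := by noncomm_ring
    _ = c * (a * c - 1) * a := by rw [hca]
    _ = c * a * (c * a - 1) := by noncomm_ring

theorem cre_sq_mul_ann_sq : cre ^ 2 * ann ^ 2 = numOp * (numOp - 1) :=
  sq_mul_sq_of_mul_eq_mul_add_one (R := Module.End ℂ FockSpace) ann_mul_cre

theorem diagOp_mul_cre_sq_mul_ann_sq (h : ℤ → ℂ) :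
    diagOp h * (cre ^ 2 * ann ^ 2) = cre ^ 2 * ann ^ 2 * diagOp h := by
  have hc := cre_sq_mul_diagOp fun n => h (n + 2)
  simp only [sub_add_cancel] at hc
  rw [← mul_assoc, ← hc, mul_assoc, diagOp_mul_ann_sq, ← mul_assoc]
  simp only [sub_add_cancel]

/-- The Lindblad identity for `A - t` and `B - t`, where `X`, `Y` satisfy the intertwining relations
`X A = A Y` and `B X = Y B` and `X` commutes with `B A`. -/
theorem lindblad_identity_of_intertwining {R : Type*} [Ring R] [Algebra ℂ R] {A B X Y : R} (t : ℂ)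
    (hA : X * A = A * Y) (hB : B * X = Y * B) (hBA : X * (B * A) = B * A * X) :
    (B - t • 1) * X * (A - t • 1) -
        (2⁻¹ : ℂ) • ((B - t • 1) * (A - t • 1) * X + X * ((B - t • 1) * (A - t • 1))) =
      -(B * A * (X - Y)) + (t * 2⁻¹) • (A * (X - Y)) + (t * 2⁻¹) • ((X - Y) * B) := by
  have hBXA : Y * B * A = B * A * Y := by rw [← hB, mul_assoc, hA, mul_assoc]
  simp only [mul_sub, sub_mul, smul_mul_assoc, mul_smul_comm, mul_one, one_mul, hBA, hA, hB, hBXA]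
  module

theorem stmt3 (α : ℝ) (hα : 0 < α) (f : ℤ → ℂ) :
    adjLind (Lop α) (Ldag α) (diagOp fun n => f n) =
      -(numOp * (numOp - 1) * diagOp (fun n => f n - f (n - 2)))
      + ((α ^ 2 / 2 : ℝ) : ℂ) • (ann ^ 2 * diagOp (fun n => f n - f (n - 2)))
      + ((α ^ 2 / 2 : ℝ) : ℂ) • (diagOp (fun n => f n - f (n - 2)) * cre ^ 2) := by
  have hα2 : ((α ^ 2 / 2 : ℝ) : ℂ) = (α : ℂ) ^ 2 * 2⁻¹ := by push_cast; ring
  rw [diagOp_sub, hα2, ← cre_sq_mul_ann_sq]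
  exact lindblad_identity_of_intertwining (R := Module.End ℂ FockSpace) _
    (diagOp_mul_ann_sq f) (cre_sq_mul_diagOp f) (diagOp_mul_cre_sq_mul_ann_sq f)

end
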